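/- Assume a compact length space X is covered by finitely many subsets such that every nonempty intersection of any subcollection of these sets (including each set itself) is isometric to a convex polytope. Then X is a polyhedral space: it admits a finite triangulation in which each simplex is isometric to a Euclidean simplex. -/

import Mathlib

open Set Metric

/-- A metric space is a length space if the distance between any two points equals the
infimum of lengths of paths connecting them. -/
def IsLengthSpace (X : Type*) [MetricSpace X] : Prop :=
  ∀ x y : X, edist x y = ⨅ γ : Path x y, eVariationOn γ Set.univ

/-- The subset `Q` of `X` is isometric to a convex polytope, i.e. to the convex hull of a
finite set of points in some Euclidean space. -/
def IsometricToConvexPolytope {X : Type*} [MetricSpace X] (Q : Set X) : Prop :=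
  ∃ (n : ℕ) (V : Finset (EuclideanSpace ℝ (Fin n))) (f : X → EuclideanSpace ℝ (Fin n)),
    (∀ a ∈ Q, ∀ b ∈ Q, dist (f a) (f b) = dist a b) ∧
    f '' Q = convexHull ℝ (V : Set (EuclideanSpace ℝ (Fin n)))

/-- Data of an isometric identification of a subset of `X` with a Euclidean simplex:
an ambient dimension `n`, vertices `v`, and a map `f`. -/
structure SimplexChart (X : Type*) [MetricSpace X] where
  n : ℕ
  k : ℕ
  v : Fin (k + 1) → EuclideanSpace ℝ (Fin n)
  f : X → EuclideanSpace ℝ (Fin n)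

/-- `c` realizes `S ⊆ X` as a Euclidean simplex: the vertices are affinely independent,
`c.f` is distance preserving on `S` and maps `S` onto the convex hull of the vertices. -/
def SimplexChart.IsChartOf {X : Type*} [MetricSpace X] (c : SimplexChart X) (S : Set X) : Prop :=
  AffineIndependent ℝ c.v ∧
  (∀ a ∈ S, ∀ b ∈ S, dist (c.f a) (c.f b) = dist a b) ∧
  c.f '' S = convexHull ℝ (Set.range c.v)

/-- The face of `S` spanned by the vertices in `σ`, under the chart `c`. -/
def SimplexChart.face {X : Type*} [MetricSpace X] (c : SimplexChart X) (S : Set X)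
    (σ : Set (Fin (c.k + 1))) : Set X :=
  {a ∈ S | c.f a ∈ convexHull ℝ (c.v '' σ)}

/-- `X` is a (compact) polyhedral space: it admits a finite triangulation whose simplices are
isometric to Euclidean simplices, closed under faces, any two simplices meeting in a common
face (possibly empty). -/
def IsPolyhedralSpace (X : Type*) [MetricSpace X] : Prop :=
  ∃ (F : Set (Set X)) (chart : ∀ S ∈ F, SimplexChart X),
    F.Finite ∧ ⋃₀ F = Set.univ ∧
    (∀ S (hS : S ∈ F), (chart S hS).IsChartOf S) ∧
    (∀ S (hS : S ∈ F), ∀ σ : Set (Fin ((chart S hS).k + 1)), σ.Nonempty →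
      (chart S hS).face S σ ∈ F) ∧
    ∀ S (hS : S ∈ F), ∀ T (hT : T ∈ F), S ∩ T = ∅ ∨
      ((∃ σ, S ∩ T = (chart S hS).face S σ) ∧ ∃ τ, S ∩ T = (chart T hT).face T τ)


/-- A finite family of affine functionals detects membership in a simplex by signs. -/
lemma AffineIndependent.exists_finite_sign_determined {E : Type*} [NormedAddCommGroup E]
    [NormedSpace ℝ E] [FiniteDimensional ℝ E] (s : Set E)
    (hs : AffineIndependent ℝ ((↑) : s → E)) :
    ∃ B : Set (E →ᵃ[ℝ] ℝ), B.Finite ∧ ∀ p q : E,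
      (∀ h ∈ B, SignType.sign (h p) = SignType.sign (h q)) →
        p ∈ convexHull ℝ s → q ∈ convexHull ℝ s := by
  obtain ⟨t, hst, htAI, htop⟩ := exists_subset_affineIndependent_affineSpan_eq_top hs
  let b : AffineBasis t ℝ E := ⟨((↑) : t → E), htAI, by simpa using htop⟩
  have hb : ∀ i : t, b i = (i : E) := fun i => rfl
  clear_value b
  have : Finite t := b.finite
  have := Fintype.ofFinite t
  refine ⟨Set.range b.coord, Set.finite_range _, fun p q hpq hp => ?_⟩
  have hpos : ∀ i, 0 ≤ b.coord i p := by
    have : p ∈ convexHull ℝ (Set.range b) := by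
      refine convexHull_mono ?_ hp
      intro x hx
      exact ⟨⟨x, hst hx⟩, hb _⟩
    rw [b.convexHull_eq_nonneg_coord] at this
    exact this
  have hzero : ∀ i : t, (i : E) ∉ s → b.coord i p = 0 := by
    intro i hi
    have hsub : convexHull ℝ s ⊆ (b.coord i) ⁻¹' {0} := by
      refine convexHull_min ?_ ((convex_singleton (0 : ℝ)).affine_preimage (b.coord i))
      intro x hx
      have hne : i ≠ (⟨x, hst hx⟩ : t) := by
        rintro rfl
        exact hi hx
      have h0 : b.coord i (b ⟨x, hst hx⟩) = 0 := b.coord_apply_ne hne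
      rw [hb] at h0
      exact h0
    exact hsub hp
  have hposq : ∀ i, 0 ≤ b.coord i q := by
    intro i
    have h1 := hpq _ ⟨i, rfl⟩
    exact sign_nonneg_iff.1 (h1 ▸ sign_nonneg_iff.2 (hpos i))
  have hzeroq : ∀ i : t, (i : E) ∉ s → b.coord i q = 0 := by
    intro i hi
    have h1 := hpq _ ⟨i, rfl⟩
    exact sign_eq_zero_iff.1 (h1 ▸ sign_eq_zero_iff.2 (hzero i hi))
  classical
  rw [← b.linear_combination_coord_eq_self q]
  have hsum := b.sum_coord_apply_eq_one q
  rw [← Finset.sum_subset (Finset.subset_univ (Finset.univ.filter fun i : t => (i : E) ∈ s))]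
  · refine (convex_convexHull ℝ s).sum_mem (fun i _ => hposq i) ?_ ?_
    · rw [← hsum]
      refine Finset.sum_subset (Finset.subset_univ _) ?_
      intro i _ hi
      exact hzeroq i (by simpa using hi)
    · intro i hi
      rw [hb]
      exact subset_convexHull ℝ s (Finset.mem_filter.1 hi).2
  · intro i _ hi
    rw [hzeroq i (by simpa using hi), zero_smul]

/-- A finite family of affine functionals detects membership in a polytope by signs. -/
lemma Set.Finite.exists_sign_determined_convexHull {E : Type*} [NormedAddCommGroup E]
    [NormedSpace ℝ E] [FiniteDimensional ℝ E] {V : Set E} (hV : V.Finite) :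
    ∃ B : Set (E →ᵃ[ℝ] ℝ), B.Finite ∧ ∀ p q : E,
      (∀ h ∈ B, SignType.sign (h p) = SignType.sign (h q)) →
        p ∈ convexHull ℝ V → q ∈ convexHull ℝ V := by
  have key : ∀ t : Set E, ∃ B : Set (E →ᵃ[ℝ] ℝ), B.Finite ∧
      (AffineIndependent ℝ ((↑) : t → E) → ∀ p q : E,
        (∀ h ∈ B, SignType.sign (h p) = SignType.sign (h q)) →
          p ∈ convexHull ℝ t → q ∈ convexHull ℝ t) := by
    intro t
    by_cases ht : AffineIndependent ℝ ((↑) : t → E)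
    · obtain ⟨B, hB, h⟩ := ht.exists_finite_sign_determined
      exact ⟨B, hB, fun _ => h⟩
    · exact ⟨∅, Set.finite_empty, fun h => absurd h ht⟩
  choose B hBfin hB using key
  refine ⟨⋃ t ∈ V.powerset, B t, hV.powerset.biUnion fun t _ => hBfin t, fun p q hpq hp => ?_⟩
  rw [convexHull_eq_union] at hp
  simp only [Set.mem_iUnion] at hp
  obtain ⟨t, htV, htAI, hpt⟩ := hp
  refine convexHull_mono htV (hB t htAI p q (fun h hh => hpq h ?_) hpt)
  exact Set.mem_biUnion (show (t : Set E) ∈ V.powerset from htV) hh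

/-- A linear map is determined on the range of `L₁` by any `L₂` whose kernel contains that of
`L₁`. -/
lemma LinearMap.exists_comp_eq_of_ker_le {M E F : Type*} [AddCommGroup M] [Module ℝ M]
    [AddCommGroup E] [Module ℝ E] [AddCommGroup F] [Module ℝ F]
    (L₁ : M →ₗ[ℝ] E) (L₂ : M →ₗ[ℝ] F) (h : ∀ m, L₁ m = 0 → L₂ m = 0) :
    ∃ g : E →ₗ[ℝ] F, ∀ m, g (L₁ m) = L₂ m := by
  obtain ⟨s, hs⟩ := L₁.rangeRestrict.exists_rightInverse_of_surjective L₁.range_rangeRestrict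
  obtain ⟨g, hg⟩ := LinearMap.exists_extend (L₂ ∘ₗ s)
  refine ⟨g, fun m => ?_⟩
  have h1 : g (L₁ m) = L₂ (s (L₁.rangeRestrict m)) := by
    have := LinearMap.congr_fun hg (L₁.rangeRestrict m)
    simpa using this
  have h2 : L₁ (s (L₁.rangeRestrict m)) = L₁ m := by
    have := LinearMap.congr_fun hs (L₁.rangeRestrict m)
    simpa using congrArg Subtype.val this
  have h3 := h (s (L₁.rangeRestrict m) - m) (by rw [map_sub, h2, sub_self])
  rw [map_sub, sub_eq_zero] at h3
  rw [h1, h3]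

/-- Two maps into Euclidean spaces inducing the same distances on a set differ there by an
affine map. -/
lemma exists_affineMap_comp_eq_of_dist_eq {X E F : Type*}
    [NormedAddCommGroup E] [InnerProductSpace ℝ E] [NormedAddCommGroup F] [InnerProductSpace ℝ F]
    (S : Set X) (f₁ : X → E) (f₂ : X → F)
    (h : ∀ a ∈ S, ∀ b ∈ S, dist (f₁ a) (f₁ b) = dist (f₂ a) (f₂ b)) :
    ∃ g : E →ᵃ[ℝ] F, ∀ x ∈ S, g (f₁ x) = f₂ x := by
  rcases S.eq_empty_or_nonempty with rfl | ⟨p, hp⟩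
  · exact ⟨AffineMap.const ℝ E 0, by simp⟩
  have hinner : ∀ a b : S, inner ℝ (f₁ a - f₁ p) (f₁ b - f₁ p)
      = inner ℝ (f₂ a - f₂ p) (f₂ b - f₂ p) := by
    intro a b
    have e1 := h a a.2 b b.2
    have e2 := h a a.2 p hp
    have e3 := h b b.2 p hp
    rw [dist_eq_norm, dist_eq_norm] at e1 e2 e3
    have d1 : f₁ a - f₁ b = (f₁ a - f₁ p) - (f₁ b - f₁ p) := by abel
    have d2 : f₂ a - f₂ b = (f₂ a - f₂ p) - (f₂ b - f₂ p) := by abel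
    rw [d1, d2] at e1
    rw [real_inner_eq_norm_mul_self_add_norm_mul_self_sub_norm_sub_mul_self_div_two,
      real_inner_eq_norm_mul_self_add_norm_mul_self_sub_norm_sub_mul_self_div_two, e1, e2, e3]
  let L₁ : (S →₀ ℝ) →ₗ[ℝ] E := Finsupp.linearCombination ℝ fun a : S => f₁ a - f₁ p
  let L₂ : (S →₀ ℝ) →ₗ[ℝ] F := Finsupp.linearCombination ℝ fun a : S => f₂ a - f₂ p
  have hL : ∀ m, inner ℝ (L₁ m) (L₁ m) = inner ℝ (L₂ m) (L₂ m) := by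
    intro m
    simp only [L₁, L₂, Finsupp.linearCombination_apply, Finsupp.sum, sum_inner, inner_sum,
      inner_smul_left, inner_smul_right, hinner]
  obtain ⟨g, hg⟩ := LinearMap.exists_comp_eq_of_ker_le L₁ L₂ (by
    intro m hm
    have := hL m
    rw [hm, inner_zero_left] at this
    exact inner_self_eq_zero.1 this.symm)
  refine ⟨g.toAffineMap.comp (AffineMap.id ℝ E - AffineMap.const ℝ E (f₁ p))
    + AffineMap.const ℝ E (f₂ p), fun x hx => ?_⟩
  have := hg (Finsupp.single ⟨x, hx⟩ 1)
  simp only [L₁, L₂, Finsupp.linearCombination_single, one_smul] at this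
  rw [map_sub] at this
  simp [this]

/-- `a` has the sign of `b`, or vanishes. -/
def SignLE (a b : ℝ) : Prop := a = 0 ∨ SignType.sign a = SignType.sign b

lemma SignLE.refl (a : ℝ) : SignLE a a := Or.inr rfl

lemma SignLE.trans {a b c : ℝ} (h₁ : SignLE a b) (h₂ : SignLE b c) : SignLE a c := by
  rcases h₁ with h₁ | h₁
  · exact Or.inl h₁
  · rcases h₂ with h₂ | h₂
    · left
      rwa [h₂, sign_zero, sign_eq_zero_iff] at h₁
    · exact Or.inr (h₁.trans h₂)

lemma SignLE.sign_eq {a b : ℝ} (h₁ : SignLE a b) (h₂ : SignLE b a) :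
    SignType.sign a = SignType.sign b := by
  rcases h₁ with h₁ | h₁
  · rcases h₂ with h₂ | h₂
    · rw [h₁, h₂]
    · exact h₂.symm
  · exact h₁

lemma SignLE.cases {a b : ℝ} (h : SignLE a b) :
    (0 < b ∧ 0 ≤ a) ∨ (b < 0 ∧ a ≤ 0) ∨ (b = 0 ∧ a = 0) := by
  rcases lt_trichotomy b 0 with hb | hb | hb
  · refine Or.inr (Or.inl ⟨hb, ?_⟩)
    rcases h with h | h
    · exact h.le
    · rw [sign_neg hb, sign_eq_neg_one_iff] at h
      exact h.le
  · refine Or.inr (Or.inr ⟨hb, ?_⟩)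
    rcases h with h | h
    · exact h
    · rwa [hb, sign_zero, sign_eq_zero_iff] at h
  · refine Or.inl ⟨hb, ?_⟩
    rcases h with h | h
    · exact h.ge
    · rw [sign_pos hb, sign_eq_one_iff] at h
      exact h.le

lemma signLE_of_nonneg {a b : ℝ} (hb : 0 < b) (ha : 0 ≤ a) : SignLE a b := by
  rcases ha.eq_or_lt with ha | ha
  · exact Or.inl ha.symm
  · exact Or.inr (by rw [sign_pos ha, sign_pos hb])

lemma signLE_of_nonpos {a b : ℝ} (hb : b < 0) (ha : a ≤ 0) : SignLE a b := by
  rcases ha.eq_or_lt with ha | ha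
  · exact Or.inl ha
  · exact Or.inr (by rw [sign_neg ha, sign_neg hb])

lemma convex_setOf_signLE (b : ℝ) : Convex ℝ {a | SignLE a b} := by
  rcases lt_trichotomy b 0 with hb | hb | hb
  · refine (Set.ext fun a => ?_ : {a | SignLE a b} = Set.Iic 0) ▸ convex_Iic (𝕜 := ℝ) (0 : ℝ)
    exact ⟨fun h => by rcases SignLE.cases h with h | h | h <;> simp <;> linarith,
      signLE_of_nonpos hb⟩
  · refine (Set.ext fun a => ?_ : {a | SignLE a b} = {0}) ▸ convex_singleton (𝕜 := ℝ) (0 : ℝ)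
    exact ⟨fun h => by rcases SignLE.cases h with h | h | h <;> simp <;> linarith, Or.inl⟩
  · refine (Set.ext fun a => ?_ : {a | SignLE a b} = Set.Ici 0) ▸ convex_Ici (𝕜 := ℝ) (0 : ℝ)
    exact ⟨fun h => by rcases SignLE.cases h with h | h | h <;> simp <;> linarith,
      signLE_of_nonneg hb⟩

lemma isClosed_setOf_signLE (b : ℝ) : IsClosed {a | SignLE a b} := by
  rcases lt_trichotomy b 0 with hb | hb | hb
  · convert isClosed_Iic (a := (0 : ℝ)) using 1
    ext a
    exact ⟨fun h => by rcases SignLE.cases h with h | h | h <;> simp <;> linarith,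
      signLE_of_nonpos hb⟩
  · convert isClosed_singleton (x := (0 : ℝ)) using 1
    ext a
    exact ⟨fun h => by rcases SignLE.cases h with h | h | h <;> simp <;> linarith, Or.inl⟩
  · convert isClosed_Ici (a := (0 : ℝ)) using 1
    ext a
    exact ⟨fun h => by rcases SignLE.cases h with h | h | h <;> simp <;> linarith,
      signLE_of_nonneg hb⟩

lemma SignLE.sign_combo_eq {a b t : ℝ} (h : SignLE b a) (ht₀ : 0 ≤ t) (ht₁ : t < 1) :
    SignType.sign ((1 - t) * a + t * b) = SignType.sign a := by
  have ht : 0 < 1 - t := by linarith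
  rcases h.cases with ⟨ha, hb⟩ | ⟨ha, hb⟩ | ⟨ha, hb⟩
  · rw [sign_pos ha, sign_pos]
    have := mul_pos ht ha
    have := mul_nonneg ht₀ hb
    linarith
  · rw [sign_neg ha, sign_neg]
    have := mul_neg_of_pos_of_neg ht ha
    have := mul_nonpos_of_nonneg_of_nonpos ht₀ hb
    linarith
  · simp [ha, hb]

/-- A finite family of polytopes covering `X`, closed under intersections. -/
structure PolytopalAtlas (X : Type*) [MetricSpace X] where
  /-- the indices of the polytopes -/
  ι : Type
  finite : Finite ι
  /-- the ambient dimensions -/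
  dim : ι → ℕ
  /-- the polytopes -/
  cell : ι → Set X
  /-- the isometric identifications with Euclidean polytopes -/
  chart : ∀ i, X → EuclideanSpace ℝ (Fin (dim i))
  /-- the vertices of the Euclidean polytopes -/
  vert : ∀ i, Set (EuclideanSpace ℝ (Fin (dim i)))
  finite_vert : ∀ i, (vert i).Finite
  dist_chart : ∀ i, ∀ a ∈ cell i, ∀ b ∈ cell i, dist (chart i a) (chart i b) = dist a b
  image_cell : ∀ i, chart i '' cell i = convexHull ℝ (vert i)
  inter : ∀ i j, ∃ k, cell k = cell i ∩ cell j
  cover : ∀ x, ∃ i, x ∈ cell i ∧ ∀ j, x ∈ cell j → cell i ⊆ cell j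

namespace PolytopalAtlas

variable {X : Type*} [MetricSpace X] (A : PolytopalAtlas X)

lemma injOn (i : A.ι) : Set.InjOn (A.chart i) (A.cell i) := by
  intro a ha b hb hab
  rw [← dist_eq_zero, ← A.dist_chart i a ha b hb, hab, dist_self]

lemma exists_transition (i j : A.ι) :
    ∃ g : EuclideanSpace ℝ (Fin (A.dim i)) →ᵃ[ℝ] EuclideanSpace ℝ (Fin (A.dim j)),
      ∀ x, x ∈ A.cell i → x ∈ A.cell j → g (A.chart i x) = A.chart j x := by
  obtain ⟨g, hg⟩ := exists_affineMap_comp_eq_of_dist_eq (A.cell i ∩ A.cell j)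
    (A.chart i) (A.chart j) (fun a ha b hb => by
      rw [A.dist_chart i a ha.1 b hb.1, A.dist_chart j a ha.2 b hb.2])
  exact ⟨g, fun x hi hj => hg x ⟨hi, hj⟩⟩

lemma exists_image_inter (i j : A.ι) : ∃ W : Set (EuclideanSpace ℝ (Fin (A.dim i))),
    W.Finite ∧ A.chart i '' (A.cell i ∩ A.cell j) = convexHull ℝ W := by
  obtain ⟨k, hk⟩ := A.inter i j
  obtain ⟨g, hg⟩ := A.exists_transition k i
  refine ⟨g '' A.vert k, (A.finite_vert k).image g, ?_⟩
  rw [← g.image_convexHull, ← A.image_cell k, Set.image_image, ← hk]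
  refine Set.image_congr fun x hx => (hg x hx ?_).symm
  exact (hk ▸ hx : x ∈ A.cell i ∩ A.cell j).1

lemma exists_sign_determined (i : A.ι) :
    ∃ B : Set (EuclideanSpace ℝ (Fin (A.dim i)) →ᵃ[ℝ] ℝ), B.Finite ∧ ∀ j p q,
      (∀ h ∈ B, SignType.sign (h p) = SignType.sign (h q)) →
        p ∈ A.chart i '' (A.cell i ∩ A.cell j) → q ∈ A.chart i '' (A.cell i ∩ A.cell j) := by
  have key : ∀ j, ∃ B : Set (EuclideanSpace ℝ (Fin (A.dim i)) →ᵃ[ℝ] ℝ), B.Finite ∧ ∀ p q,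
      (∀ h ∈ B, SignType.sign (h p) = SignType.sign (h q)) →
        p ∈ A.chart i '' (A.cell i ∩ A.cell j) → q ∈ A.chart i '' (A.cell i ∩ A.cell j) := by
    intro j
    obtain ⟨W, hW, h⟩ := A.exists_image_inter i j
    rw [h]
    exact hW.exists_sign_determined_convexHull
  choose B hfin hB using key
  have := A.finite
  refine ⟨⋃ j, B j, Set.finite_iUnion hfin, fun j p q h => hB j p q fun u hu => ?_⟩
  exact h u (Set.mem_iUnion.2 ⟨j, hu⟩)

/-- Affine functionals on the `i`-th chart whose signs detect the overlaps with all cells. -/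
noncomputable def walls (i : A.ι) : Set (EuclideanSpace ℝ (Fin (A.dim i)) →ᵃ[ℝ] ℝ) :=
  (A.exists_sign_determined i).choose

lemma finite_walls (i : A.ι) : (A.walls i).Finite := (A.exists_sign_determined i).choose_spec.1

lemma walls_spec (i j : A.ι) {p q : EuclideanSpace ℝ (Fin (A.dim i))}
    (h : ∀ u ∈ A.walls i, SignType.sign (u p) = SignType.sign (u q))
    (hp : p ∈ A.chart i '' (A.cell i ∩ A.cell j)) :
    q ∈ A.chart i '' (A.cell i ∩ A.cell j) :=
  (A.exists_sign_determined i).choose_spec.2 j p q h hp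

/-- The `d`-th cell is the smallest cell of the atlas containing `c`. -/
def IsIdx (d : A.ι) (c : X) : Prop :=
  c ∈ A.cell d ∧ ∀ j, c ∈ A.cell j → A.cell d ⊆ A.cell j

/-- `y` lies in the closure of the stratum of `x`, where the strata are cut out of the atlas by
all the walls. -/
def Le (y x : X) : Prop :=
  (∀ i, x ∈ A.cell i → y ∈ A.cell i) ∧
    ∀ i, x ∈ A.cell i → ∀ u ∈ A.walls i, SignLE (u (A.chart i y)) (u (A.chart i x))

variable {A}

lemma Le.refl (x : X) : A.Le x x := ⟨fun _ h => h, fun _ _ _ _ => SignLE.refl _⟩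

lemma Le.trans {x y z : X} (h₁ : A.Le x y) (h₂ : A.Le y z) : A.Le x z :=
  ⟨fun i hi => h₁.1 i (h₂.1 i hi),
    fun i hi u hu => (h₁.2 i (h₂.1 i hi) u hu).trans (h₂.2 i hi u hu)⟩

lemma Le.mem {x y : X} {d : A.ι} (h : A.Le y x) (hd : A.IsIdx d x) : y ∈ A.cell d :=
  h.1 _ hd.1

/-- The stratum of `c` and its closure are described by the signs of finitely many affine
functionals on a single chart. -/
lemma exists_functionals {c : X} {d : A.ι} (hd : A.IsIdx d c) :
    ∃ U : Set (EuclideanSpace ℝ (Fin (A.dim d)) →ᵃ[ℝ] ℝ), U.Finite ∧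
      (∀ y ∈ A.cell d, A.Le y c ↔
        ∀ u ∈ U, SignLE (u (A.chart _ y)) (u (A.chart _ c))) ∧
      (∀ p, (∀ u ∈ U, SignType.sign (u p) = SignType.sign (u (A.chart _ c))) →
        ∃ z ∈ A.cell d, A.chart _ z = p ∧ A.Le z c ∧ A.Le c z) ∧
      (∀ y, A.Le y c → A.Le c y →
        ∀ u ∈ U, SignType.sign (u (A.chart _ y)) = SignType.sign (u (A.chart _ c))) := by
  have := A.finite
  choose g hg using A.exists_transition d
  have hmem := hd.1
  let U : Set (EuclideanSpace ℝ (Fin (A.dim d)) →ᵃ[ℝ] ℝ) :=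
    A.walls d ∪ ⋃ i ∈ {i | c ∈ A.cell i}, (fun u => u.comp (g i)) '' A.walls i
  have hUd : ∀ u ∈ A.walls d, u ∈ U := fun u hu => Or.inl hu
  have hUi : ∀ i, c ∈ A.cell i → ∀ u ∈ A.walls i, u.comp (g i) ∈ U := fun i hi u hu =>
    Or.inr (Set.mem_biUnion (show i ∈ {i | c ∈ A.cell i} from hi) ⟨u, hu, rfl⟩)
  have hval : ∀ i, c ∈ A.cell i → ∀ y ∈ A.cell d, ∀ u : _ →ᵃ[ℝ] ℝ,
      (u.comp (g i)) (A.chart d y) = u (A.chart i y) := by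
    intro i hi y hy u
    rw [AffineMap.comp_apply, hg i y hy (hd.2 i hi hy)]
  have key : ∀ P : ℝ → ℝ → Prop, ∀ y ∈ A.cell d,
      ((∀ u ∈ U, P (u (A.chart d y)) (u (A.chart d c))) ↔
        ∀ i, c ∈ A.cell i → ∀ u ∈ A.walls i, P (u (A.chart i y)) (u (A.chart i c))) := by
    intro P y hy
    constructor
    · intro h i hi u hu
      have := h _ (hUi i hi u hu)
      rwa [hval i hi y hy, hval i hi c hmem] at this
    · rintro h u (hu | hu)
      · exact h d hmem u hu
      · simp only [Set.mem_iUnion] at hu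
        obtain ⟨i, hi, v, hv, rfl⟩ := hu
        have := h i hi v hv
        simp only
        rwa [hval i hi y hy, hval i hi c hmem]
  have hle : ∀ y ∈ A.cell d, A.Le y c ↔
      ∀ u ∈ U, SignLE (u (A.chart _ y)) (u (A.chart _ c)) := by
    intro y hy
    rw [key SignLE y hy]
    exact ⟨fun h => h.2, fun h => ⟨fun i hi => hd.2 i hi hy, h⟩⟩
  refine ⟨U, ?_, hle, ?_, ?_⟩
  · exact (A.finite_walls d).union
      ((Set.toFinite _).biUnion fun i _ => (A.finite_walls i).image _)
  · intro p hp
    obtain ⟨z, ⟨hz, -⟩, rfl⟩ := A.walls_spec d d (fun u hu => (hp u (hUd u hu)).symm)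
      ⟨c, ⟨hmem, hmem⟩, rfl⟩
    refine ⟨z, hz, rfl, (hle z hz).2 fun u hu => Or.inr (hp u hu), ?_⟩
    have hmem' : ∀ i, z ∈ A.cell i → c ∈ A.cell i := by
      intro i hi
      obtain ⟨c', hc', hcc⟩ := A.walls_spec d i (fun u hu => hp u (hUd u hu)) ⟨z, ⟨hz, hi⟩, rfl⟩
      rw [← A.injOn d hc'.1 hmem hcc]
      exact hc'.2
    refine ⟨hmem', fun i hi u hu => Or.inr ?_⟩
    exact ((key (fun a b => SignType.sign a = SignType.sign b) z hz).1 hp i (hmem' i hi) u hu).symm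
  · intro y h₁ h₂
    refine (key (fun a b => SignType.sign a = SignType.sign b) y (h₁.mem hd)).2 ?_
    intro i hi u hu
    exact (h₁.2 i hi u hu).sign_eq (h₂.2 i (h₁.1 i hi) u hu)

/-- A half-open segment from a stratum to a point of its closure stays in the stratum. -/
lemma le_of_segment {c x y z : X} {d : A.ι} (hd : A.IsIdx d c) (hxc : A.Le x c) (hcx : A.Le c x) (hy : A.Le y c)
    (hz : z ∈ A.cell d) {t : ℝ} (ht₀ : 0 ≤ t) (ht₁ : t < 1)
    (h : A.chart d z = (1 - t) • A.chart d x + t • A.chart d y) :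
    A.Le z c ∧ A.Le c z := by
  obtain ⟨U, -, hle, hex, heq⟩ := exists_functionals hd
  obtain ⟨z', hz', hzz, h1⟩ := hex (A.chart _ z) (by
    intro u hu
    rw [h, Convex.combo_affine_apply (by ring), ← heq x hxc hcx u hu]
    refine SignLE.sign_combo_eq ?_ ht₀ ht₁
    refine ((hle y (hy.mem hd)).1 hy u hu).trans (Or.inr ?_)
    rw [heq x hxc hcx u hu])
  rwa [A.injOn _ hz' hz hzz] at h1

/-- A ray from `c` through another point of its stratum leaves the stratum in a point of its
frontier. -/
lemma exists_exit {c x : X} {d : A.ι} (hd : A.IsIdx d c) (hxc : A.Le x c) (hcx : A.Le c x) (hne : x ≠ c) :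
    ∃ y, A.Le y c ∧ ¬ A.Le c y ∧ ∃ t : ℝ, 0 < t ∧ t < 1 ∧
      A.chart d x = (1 - t) • A.chart d c + t • A.chart d y := by
  obtain ⟨U, hU, hle, hex, heq⟩ := exists_functionals hd
  have hmem := hd.1
  set D : Set (EuclideanSpace ℝ (Fin (A.dim d))) := convexHull ℝ (A.vert d) ∩
    {p | ∀ u ∈ U, SignLE (u p) (u (A.chart d c))} with hD
  have hDmem : ∀ p, p ∈ D ↔ ∃ y ∈ A.cell d, A.chart d y = p ∧ A.Le y c := by
    intro p
    rw [hD, ← A.image_cell d]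
    constructor
    · rintro ⟨⟨y, hy, rfl⟩, hp⟩
      exact ⟨y, hy, rfl, (hle y hy).2 hp⟩
    · rintro ⟨y, hy, rfl, hyc⟩
      exact ⟨⟨y, hy, rfl⟩, (hle y hy).1 hyc⟩
  have hDc : IsCompact D := by
    refine (A.finite_vert d).isCompact_convexHull (𝕜 := ℝ) |>.inter_right ?_
    simp only [Set.ofPred_forall]
    refine isClosed_biInter fun u _ => ?_
    exact (isClosed_setOf_signLE _).preimage u.continuous_of_finiteDimensional
  set v := A.chart d x - A.chart d c with hv
  have hv0 : v ≠ 0 := fun h0 => hne (A.injOn d (hxc.mem hd) hmem (sub_eq_zero.1 h0))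
  let p : ℝ → EuclideanSpace ℝ (Fin (A.dim d)) := fun t => A.chart d c + t • v
  have hp : Continuous p := by fun_prop
  have hT : IsCompact (p ⁻¹' D) := by
    refine Metric.isCompact_of_isClosed_isBounded (hDc.isClosed.preimage hp) ?_
    obtain ⟨R, hR⟩ := hDc.isBounded.exists_norm_le
    rw [isBounded_iff_forall_norm_le]
    refine ⟨(R + ‖A.chart d c‖) / ‖v‖, fun t ht => ?_⟩
    rw [le_div_iff₀ (norm_pos_iff.2 hv0), ← norm_smul]
    have h1 : t • v = p t - A.chart d c := by simp [p]
    rw [h1]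
    exact (norm_sub_le _ _).trans (by gcongr; exact hR _ ht)
  have h1T : (1 : ℝ) ∈ p ⁻¹' D := by
    rw [Set.mem_preimage, hDmem]
    exact ⟨x, (hxc.mem hd), by simp [p, hv], hxc⟩
  obtain ⟨T, hTD, hTmax⟩ := hT.exists_isGreatest ⟨1, h1T⟩
  have hT1 : 1 ≤ T := hTmax h1T
  obtain ⟨y, hy, hyp, hyc⟩ := (hDmem _).1 hTD
  have hup : ∀ (u : EuclideanSpace ℝ (Fin (A.dim d)) →ᵃ[ℝ] ℝ) (t : ℝ),
      u (p t) = u (A.chart d c) + t * u.linear v := by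
    intro u t
    simp only [p]
    rw [add_comm, ← vadd_eq_add, u.map_vadd, map_smul, vadd_eq_add, smul_eq_mul, add_comm]
  have hnot : ¬ A.Le c y := by
    intro hcy
    have hev : ∀ u ∈ U, ∀ᶠ t in nhds T,
        SignType.sign (u (p t)) = SignType.sign (u (A.chart d c)) := by
      intro u hu
      have hs := heq y hyc hcy u hu
      rw [hyp] at hs
      have hcont : Continuous fun t => u (p t) := u.continuous_of_finiteDimensional.comp hp
      rcases lt_trichotomy (u (A.chart d c)) 0 with h0 | h0 | h0
      · rw [sign_neg h0] at hs ⊢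
        rw [sign_eq_neg_one_iff] at hs
        filter_upwards [hcont.continuousAt.eventually_lt_const hs] with t ht
        exact sign_neg ht
      · rw [h0, sign_zero, sign_eq_zero_iff, hup, h0, zero_add] at hs
        have hv : u.linear v = 0 := (mul_eq_zero.1 hs).resolve_left (by linarith)
        exact Filter.Eventually.of_forall fun t => by rw [hup, hv, mul_zero, add_zero]
      · rw [sign_pos h0] at hs ⊢
        rw [sign_eq_one_iff] at hs
        filter_upwards [hcont.continuousAt.eventually_const_lt hs] with t ht
        exact sign_pos ht
    have hall := (Filter.eventually_all_finite hU).2 hev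
    obtain ⟨t, ht, htT⟩ := ((hall.filter_mono nhdsWithin_le_nhds).and
      (self_mem_nhdsWithin (s := Set.Ioi T))).exists
    obtain ⟨z, hz, hzp, hzc, -⟩ := hex (p t) ht
    exact absurd (hTmax ((hDmem _).2 ⟨z, hz, hzp, hzc⟩)) (not_le.2 htT)
  have hT1' : 1 < T := by
    refine lt_of_le_of_ne hT1 ?_
    rintro rfl
    have hxy : y = x := A.injOn d hy (hxc.mem hd) (by rw [hyp]; simp [p, hv])
    exact hnot (hxy ▸ hcx)
  refine ⟨y, hyc, hnot, T⁻¹, by positivity, inv_lt_one_of_one_lt₀ hT1', ?_⟩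
  have hT0 : T ≠ 0 := by positivity
  rw [hyp]
  simp only [p, smul_add, smul_smul, inv_mul_cancel₀ hT0, hv]
  module

variable (A)

/-- The index of the smallest cell of the atlas containing `x`. -/
noncomputable def idx (x : X) : A.ι := (A.cover x).choose

lemma isIdx_idx (x : X) : A.IsIdx (A.idx x) x := (A.cover x).choose_spec

/-- Finitely many points represent all strata, each exactly once. -/
lemma exists_representatives : ∃ C : Set X, C.Finite ∧
    (∀ x, ∃ c ∈ C, A.Le x c ∧ A.Le c x) ∧
      ∀ a ∈ C, ∀ b ∈ C, A.Le a b → A.Le b a → a = b := by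
  have := A.finite
  have : ∀ i, Finite (A.walls i) := fun i => A.finite_walls i
  let S : Setoid X := ⟨fun x y => A.Le x y ∧ A.Le y x, fun x => ⟨Le.refl x, Le.refl x⟩,
    fun h => ⟨h.2, h.1⟩, fun h₁ h₂ => ⟨h₁.1.trans h₂.1, h₂.2.trans h₁.2⟩⟩
  have hout : ∀ x, A.Le (Quotient.mk S x).out x ∧ A.Le x (Quotient.mk S x).out :=
    fun x => Quotient.mk_out (s := S) x
  let sig : X → (A.ι → Prop) × (∀ i, A.walls i → SignType) :=
    fun x => (fun i => x ∈ A.cell i, fun i u => SignType.sign (u.1 (A.chart i x)))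
  have hsig : ∀ x y, sig x = sig y → A.Le x y := by
    intro x y h
    rw [Prod.ext_iff] at h
    refine ⟨fun i hi => (congrFun h.1 i).mpr hi, fun i hi u hu => Or.inr ?_⟩
    exact congrFun (congrFun h.2 i) ⟨u, hu⟩
  have hinj : ∀ a ∈ Set.range (Quotient.out (s := S)), ∀ b ∈ Set.range (Quotient.out (s := S)),
      A.Le a b → A.Le b a → a = b := by
    rintro _ ⟨p, rfl⟩ _ ⟨q, rfl⟩ h₁ h₂
    exact congrArg _ (Quotient.out_equiv_out.1 ⟨h₁, h₂⟩)
  refine ⟨Set.range (Quotient.out (s := S)), ?_, ?_, hinj⟩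
  · exact Set.Finite.of_finite_image (f := sig) (Set.toFinite _) fun a ha b hb hab =>
      hinj a ha b hb (hsig a b hab) (hsig b a hab.symm)
  · exact fun x => ⟨_, ⟨_, rfl⟩, (hout x).2, (hout x).1⟩

lemma convex_image_inter (i j : A.ι) : Convex ℝ (A.chart i '' (A.cell i ∩ A.cell j)) := by
  obtain ⟨W, -, h⟩ := A.exists_image_inter i j
  rw [h]
  exact convex_convexHull ℝ W

/-- The convex hull of a set of points of `X` contained in one cell of the atlas. -/
def hull (s : Set X) : Set X :=
  {x | ∃ i, s ⊆ A.cell i ∧ x ∈ A.cell i ∧ A.chart i x ∈ convexHull ℝ (A.chart i '' s)}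

variable {A}

lemma convexHull_image_subset {s : Set X} {i j : A.ι} (hi : s ⊆ A.cell i) (hj : s ⊆ A.cell j) :
    convexHull ℝ (A.chart i '' s) ⊆ A.chart i '' (A.cell i ∩ A.cell j) :=
  convexHull_min (Set.image_mono (Set.subset_inter hi hj)) (A.convex_image_inter i j)

lemma mem_hull_iff {s : Set X} {i : A.ι} (hs : s ⊆ A.cell i) {x : X} :
    x ∈ A.hull s ↔ x ∈ A.cell i ∧ A.chart i x ∈ convexHull ℝ (A.chart i '' s) := by
  refine ⟨?_, fun h => ⟨i, hs, h⟩⟩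
  rintro ⟨j, hj, hxj, hx⟩
  obtain ⟨z, ⟨hzj, hzi⟩, hz⟩ := convexHull_image_subset hj hs hx
  obtain rfl := A.injOn j hzj hxj hz
  obtain ⟨g, hg⟩ := A.exists_transition j i
  refine ⟨hzi, ?_⟩
  have h1 := Set.mem_image_of_mem g hx
  rw [g.image_convexHull, Set.image_image, hg z hzj hzi] at h1
  rwa [Set.image_congr fun a ha => hg a (hj ha) (hs ha)] at h1

lemma image_hull {s : Set X} {i : A.ι} (hs : s ⊆ A.cell i) :
    A.chart i '' A.hull s = convexHull ℝ (A.chart i '' s) := by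
  ext p
  constructor
  · rintro ⟨x, hx, rfl⟩
    exact ((mem_hull_iff hs).1 hx).2
  · intro hp
    obtain ⟨x, ⟨hx, -⟩, rfl⟩ := convexHull_image_subset hs hs hp
    exact ⟨x, (mem_hull_iff hs).2 ⟨hx, hp⟩, rfl⟩

lemma hull_empty : A.hull ∅ = ∅ := by
  ext x
  simp [hull]

lemma hull_mono {s t : Set X} {i : A.ι} (ht : t ⊆ A.cell i) (hst : s ⊆ t) :
    A.hull s ⊆ A.hull t := by
  intro x hx
  rw [mem_hull_iff (hst.trans ht)] at hx
  rw [mem_hull_iff ht]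
  exact ⟨hx.1, convexHull_mono (Set.image_mono hst) hx.2⟩

lemma mem_hull_singleton (c : X) : c ∈ A.hull {c} :=
  ⟨A.idx c, by simpa using (A.isIdx_idx c).1, (A.isIdx_idx c).1, by simp⟩

/-- A point of the segment from `c` to a point of `hull s` lies in `hull (insert c s)`. -/
lemma mem_hull_insert {s : Set X} {c x y : X} (hs : ∀ a ∈ s, A.Le a c) (hy : y ∈ A.hull s)
    (hx : x ∈ A.cell (A.idx c)) {t : ℝ} (ht₀ : 0 ≤ t) (ht₁ : t ≤ 1)
    (h : A.chart (A.idx c) x = (1 - t) • A.chart (A.idx c) c + t • A.chart (A.idx c) y) :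
    x ∈ A.hull (insert c s) := by
  have hd := A.isIdx_idx c
  have hs' : s ⊆ A.cell (A.idx c) := fun a ha => (hs a ha).mem hd
  rw [mem_hull_iff (Set.insert_subset hd.1 hs')]
  refine ⟨hx, ?_⟩
  rw [h]
  refine convex_convexHull ℝ _ (subset_convexHull ℝ _ (Set.mem_image_of_mem _ (Set.mem_insert c s))) ?_
    (by linarith) ht₀ (by ring)
  exact convexHull_mono (Set.image_mono (Set.subset_insert _ _)) ((mem_hull_iff hs').1 hy).2

lemma le_of_mem_hull {s : Set X} {c x : X} (hs : ∀ a ∈ s, A.Le a c) (hx : x ∈ A.hull s) :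
    A.Le x c := by
  have hd := A.isIdx_idx c
  have hs' : s ⊆ A.cell (A.idx c) := fun a ha => (hs a ha).mem hd
  obtain ⟨U, -, hle, -, -⟩ := exists_functionals hd
  rw [mem_hull_iff hs'] at hx
  rw [hle x hx.1]
  intro u hu
  have hsub : convexHull ℝ (A.chart (A.idx c) '' s) ⊆
      u ⁻¹' {a | SignLE a (u (A.chart (A.idx c) c))} := by
    refine convexHull_min ?_ ((convex_setOf_signLE _).affine_preimage u)
    rintro _ ⟨a, ha, rfl⟩
    exact (hle a (hs' ha)).1 (hs a ha) u hu
  exact hsub hx.2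

/-- Two rays from `c` through the same point of its stratum meet the frontier of the stratum in
the same point. -/
lemma ray_unique {c y y' : X} (hy : A.Le y c) (hy' : A.Le y' c) (hyc : ¬ A.Le c y)
    (hyc' : ¬ A.Le c y') {t t' : ℝ} (ht : 0 < t) (ht' : 0 < t')
    (h : (1 - t) • A.chart (A.idx c) c + t • A.chart (A.idx c) y =
      (1 - t') • A.chart (A.idx c) c + t' • A.chart (A.idx c) y') : y = y' := by
  have hd := A.isIdx_idx c
  have key : ∀ {y y' : X}, A.Le y c → A.Le y' c → ¬ A.Le c y' → ∀ {t t' : ℝ}, 0 < t →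
      (1 - t) • A.chart (A.idx c) c + t • A.chart (A.idx c) y =
        (1 - t') • A.chart (A.idx c) c + t' • A.chart (A.idx c) y' → ¬ t < t' := by
    intro y y' hy hy' hyc' t t' ht h htt
    have ht' : 0 < t' := ht.trans htt
    refine hyc' (le_of_segment hd (Le.refl c) (Le.refl c) hy (hy'.mem hd) (t := t'⁻¹ * t)
      (by positivity) ((inv_mul_lt_one₀ ht').2 htt) ?_).2
    have h1 : A.chart (A.idx c) y' = t'⁻¹ • ((1 - t) • A.chart (A.idx c) c +
        t • A.chart (A.idx c) y - (1 - t') • A.chart (A.idx c) c) := by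
      rw [h, add_sub_cancel_left, smul_smul, inv_mul_cancel₀ ht'.ne', one_smul]
    rw [h1]
    match_scalars <;> field_simp
    ring
  obtain rfl : t = t' :=
    le_antisymm (not_lt.1 (key hy' hy hyc ht' h.symm)) (not_lt.1 (key hy hy' hyc' ht h))
  exact A.injOn _ (hy.mem hd) (hy'.mem hd) (smul_right_injective _ ht.ne' (add_left_cancel h))

variable (A)

/-- A finite chain of points in pairwise different strata. -/
structure IsFlag (s : Set X) : Prop where
  finite : s.Finite
  chain : IsChain A.Le s
  antisymm : ∀ a ∈ s, ∀ b ∈ s, A.Le a b → A.Le b a → a = b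

/-- The elements of `s` strictly below `c`. -/
def below (s : Set X) (c : X) : Set X := {a ∈ s | a ≠ c ∧ A.Le a c}

variable {A}

lemma below_subset (s : Set X) (c : X) : A.below s c ⊆ s := fun _ h => h.1

lemma IsFlag.mono {s t : Set X} (ht : A.IsFlag t) (hst : s ⊆ t) : A.IsFlag s :=
  ⟨ht.finite.subset hst, ht.chain.mono hst,
    fun a ha b hb => ht.antisymm a (hst ha) b (hst hb)⟩

lemma IsFlag.exists_top {s : Set X} (hs : A.IsFlag s) (hne : s.Nonempty) :
    ∃ c ∈ s, ∀ a ∈ s, A.Le a c := by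
  obtain ⟨hfin, hchain, -⟩ := hs
  induction s, hfin using Set.Finite.induction_on with
  | empty => exact absurd hne Set.not_nonempty_empty
  | @insert a s _ _ ih =>
    rcases s.eq_empty_or_nonempty with rfl | hs
    · exact ⟨a, Set.mem_insert _ _, by simp [Le.refl]⟩
    · obtain ⟨c, hc, hcs⟩ := ih hs (hchain.mono (Set.subset_insert _ _))
      rcases eq_or_ne a c with rfl | hac
      · exact ⟨a, Set.mem_insert _ _, by simpa [Le.refl] using hcs⟩
      rcases hchain (Set.mem_insert _ _) (Set.mem_insert_of_mem _ hc) hac with h | h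
      · exact ⟨c, Set.mem_insert_of_mem _ hc, by simpa [h] using hcs⟩
      · refine ⟨a, Set.mem_insert _ _, ?_⟩
        rintro b (rfl | hb)
        · exact Le.refl _
        · exact (hcs b hb).trans h

lemma IsFlag.exists_subset_cell {s : Set X} (hs : A.IsFlag s) (hne : s.Nonempty) :
    ∃ i, s ⊆ A.cell i := by
  obtain ⟨c, -, hc⟩ := hs.exists_top hne
  exact ⟨A.idx c, fun a ha => (hc a ha).mem (A.isIdx_idx c)⟩

/-- A point of the hull of a flag is in the stratum of a unique member `c` of the flag, and is
either equal to `c` or obtained from `c` and a point of the hull of the smaller members. -/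
lemma IsFlag.exists_decomposition {s : Set X} (hs : A.IsFlag s) {x : X} (hx : x ∈ A.hull s) :
    ∃ c ∈ s, A.Le x c ∧ A.Le c x ∧ (x = c ∨ ∃ y ∈ A.hull (A.below s c), ∃ t : ℝ, 0 < t ∧ t < 1 ∧
      A.chart (A.idx c) x = (1 - t) • A.chart (A.idx c) c + t • A.chart (A.idx c) y) := by
  induction hn : s.ncard using Nat.strong_induction_on generalizing s with
  | _ n ih =>
  have hne : s.Nonempty := by
    by_contra h
    rw [Set.not_nonempty_iff_eq_empty.1 h, hull_empty] at hx
    exact hx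
  obtain ⟨c, hc, hcs⟩ := hs.exists_top hne
  have hd := A.isIdx_idx c
  have hsd : s ⊆ A.cell (A.idx c) := fun a ha => (hcs a ha).mem hd
  have hbd : A.below s c ⊆ A.cell (A.idx c) := (below_subset s c).trans hsd
  have hins : s = insert c (A.below s c) := by
    ext a
    constructor
    · intro ha
      rcases eq_or_ne a c with h | h
      · exact Or.inl h
      · exact Or.inr ⟨ha, h, hcs a ha⟩
    · rintro (rfl | ha)
      · exact hc
      · exact ha.1
  have hx' := (mem_hull_iff hsd).1 hx
  by_cases hb : (A.below s c).Nonempty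
  swap
  · rw [hins, Set.not_nonempty_iff_eq_empty.1 hb] at hx'
    have hxc : x = c := A.injOn _ hx'.1 hd.1 (by simpa using hx'.2)
    subst hxc
    exact ⟨x, hc, Le.refl x, Le.refl x, Or.inl rfl⟩
  have hseg := hx'.2
  rw [hins, Set.image_insert_eq, convexHull_insert (hb.image _), mem_convexJoin] at hseg
  obtain ⟨_, rfl, q, hq, a, t, ha, ht, hat, hxq⟩ := hseg
  rw [← image_hull hbd] at hq
  obtain ⟨y, hy, rfl⟩ := hq
  obtain rfl : a = 1 - t := by linarith
  have hyd := ((mem_hull_iff hbd).1 hy).1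
  have hyc : A.Le y c := le_of_mem_hull (fun a ha => ha.2.2) hy
  rcases ht.eq_or_lt with rfl | ht0
  · have hxc : x = c := A.injOn _ hx'.1 hd.1 (by rw [← hxq]; simp)
    subst hxc
    exact ⟨x, hc, Le.refl x, Le.refl x, Or.inl rfl⟩
  rcases (sub_nonneg.1 ha).eq_or_lt with rfl | ht1
  · have hxy : x = y := A.injOn _ hx'.1 hyd (by rw [← hxq]; simp)
    subst hxy
    obtain ⟨c', hc', h₁, h₂, h₃⟩ := ih _ (hn ▸ Set.ncard_lt_ncard
      ⟨below_subset s c, fun h => (h hc).2.1 rfl⟩ hs.finite) (hs.mono (below_subset s c)) hy rfl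
    refine ⟨c', hc'.1, h₁, h₂, ?_⟩
    have hbb : A.below (A.below s c) c' = A.below s c' := by
      ext a
      refine ⟨fun h => ⟨h.1.1, h.2⟩, fun h => ⟨⟨h.1, ?_, h.2.2.trans hc'.2.2⟩, h.2⟩⟩
      rintro rfl
      exact hc'.2.1 (hs.antisymm _ hc'.1 _ hc hc'.2.2 h.2.2)
    rwa [hbb] at h₃
  · obtain ⟨h₁, h₂⟩ := le_of_segment hd (Le.refl c) (Le.refl c) hyc hx'.1 ht ht1 hxq.symm
    exact ⟨c, hc, h₁, h₂, Or.inr ⟨y, hy, t, ht0, ht1, hxq.symm⟩⟩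

lemma IsFlag.lt_of_mem_hull_below {s : Set X} (hs : A.IsFlag s) {c y : X} (hc : c ∈ s)
    (hy : y ∈ A.hull (A.below s c)) : A.Le y c ∧ ¬ A.Le c y := by
  refine ⟨le_of_mem_hull (fun a ha => ha.2.2) hy, fun h => ?_⟩
  obtain ⟨b, hb, h₁, -, -⟩ := (hs.mono (below_subset s c)).exists_decomposition hy
  exact hb.2.1 (hs.antisymm b hb.1 c hc hb.2.2 (h.trans h₁))

/-- The hulls of two flags with common representatives intersect in the hull of the common
part. -/
lemma hull_inter_subset {C s t : Set X}
    (hC : ∀ a ∈ C, ∀ b ∈ C, A.Le a b → A.Le b a → a = b) (hsC : s ⊆ C) (htC : t ⊆ C)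
    (hs : A.IsFlag s) (ht : A.IsFlag t) : A.hull s ∩ A.hull t ⊆ A.hull (s ∩ t) := by
  rintro x ⟨hxs, hxt⟩
  induction hn : s.ncard using Nat.strong_induction_on generalizing s t x with
  | _ n ih =>
  obtain ⟨c, hcs, hxc, hcx, hS⟩ := hs.exists_decomposition hxs
  obtain ⟨c', hct, hxc', hcx', hT⟩ := ht.exists_decomposition hxt
  obtain rfl : c = c' := hC c (hsC hcs) c' (htC hct) (hcx.trans hxc') (hcx'.trans hxc)
  obtain ⟨i, hi⟩ := hs.exists_subset_cell ⟨c, hcs⟩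
  have hd := A.isIdx_idx c
  have hsti : s ∩ t ⊆ A.cell i := Set.inter_subset_left.trans hi
  by_cases hxc0 : x = c
  · subst hxc0
    exact hull_mono hsti (Set.singleton_subset_iff.2 ⟨hcs, hct⟩) (mem_hull_singleton x)
  obtain ⟨y, hy, r, hr0, hr1, hxy⟩ := hS.resolve_left hxc0
  obtain ⟨y', hy', r', hr0', -, hxy'⟩ := hT.resolve_left hxc0
  obtain ⟨h₁, h₂⟩ := hs.lt_of_mem_hull_below hcs hy
  obtain ⟨h₁', h₂'⟩ := ht.lt_of_mem_hull_below hct hy'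
  obtain rfl := ray_unique h₁ h₁' h₂ h₂' hr0 hr0' (hxy.symm.trans hxy')
  have hlt : (A.below s c).ncard < n := hn ▸ Set.ncard_lt_ncard
    ⟨below_subset s c, fun h => (h hcs).2.1 rfl⟩ hs.finite
  have hyst := ih _ hlt ((below_subset s c).trans hsC) ((below_subset t c).trans htC)
    (hs.mono (below_subset s c)) (ht.mono (below_subset t c)) hy hy' rfl
  refine hull_mono hsti ?_ (mem_hull_insert (fun a ha => ha.1.2.2) hyst (hxc.mem hd)
    hr0.le hr1.le hxy)
  rintro a (rfl | ha)
  · exact ⟨hcs, hct⟩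
  · exact ⟨ha.1.1, ha.2.1⟩

lemma hull_inter {C s t : Set X}
    (hC : ∀ a ∈ C, ∀ b ∈ C, A.Le a b → A.Le b a → a = b) (hsC : s ⊆ C) (htC : t ⊆ C)
    (hs : A.IsFlag s) (ht : A.IsFlag t) : A.hull s ∩ A.hull t = A.hull (s ∩ t) := by
  refine (hull_inter_subset hC hsC htC hs ht).antisymm fun x hx => ?_
  rcases (s ∩ t).eq_empty_or_nonempty with h | ⟨a, has, hat⟩
  · rw [h, hull_empty] at hx
    exact hx.elim
  obtain ⟨i, hi⟩ := hs.exists_subset_cell ⟨a, has⟩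
  obtain ⟨j, hj⟩ := ht.exists_subset_cell ⟨a, hat⟩
  exact ⟨hull_mono hi Set.inter_subset_left hx, hull_mono hj Set.inter_subset_right hx⟩

lemma IsFlag.affineIndependent {s : Set X} (hs : A.IsFlag s) {i : A.ι} (hi : s ⊆ A.cell i) :
    AffineIndependent ℝ fun a : s => A.chart i a := by
  by_contra h
  obtain ⟨I, p, hp, hp'⟩ := Convex.radon_partition h
  have hsub : ∀ J : Set s, (Subtype.val '' J : Set X) ⊆ s := fun J => Subtype.coe_image_subset s J
  have himg : ∀ J : Set s, (fun a : s => A.chart i a) '' J = A.chart i '' (Subtype.val '' J) :=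
    fun J => (Set.image_image _ _ _).symm
  rw [himg, ← image_hull ((hsub _).trans hi)] at hp hp'
  obtain ⟨x, hx, rfl⟩ := hp
  obtain ⟨x', hx', hxx⟩ := hp'
  obtain rfl : x' = x := A.injOn i ((mem_hull_iff ((hsub _).trans hi)).1 hx').1
    ((mem_hull_iff ((hsub _).trans hi)).1 hx).1 hxx
  have hmem := hull_inter_subset hs.antisymm (hsub _) (hsub _) (hs.mono (hsub _))
    (hs.mono (hsub _)) ⟨hx, hx'⟩
  rw [← Set.image_inter Subtype.val_injective, Set.inter_compl_self, Set.image_empty,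
    hull_empty] at hmem
  exact hmem

/-- Every point lies in the hull of a flag of representatives. -/
lemma exists_flag_mem_hull {C : Set X} (hfin : C.Finite)
    (hrep : ∀ x, ∃ c ∈ C, A.Le x c ∧ A.Le c x)
    (hC : ∀ a ∈ C, ∀ b ∈ C, A.Le a b → A.Le b a → a = b) (x : X) :
    ∃ s ⊆ C, A.IsFlag s ∧ (∀ a ∈ s, A.Le a x) ∧ x ∈ A.hull s := by
  have hflag : ∀ s ⊆ C, IsChain A.Le s → A.IsFlag s := fun s hs h =>
    ⟨hfin.subset hs, h, fun a ha b hb => hC a (hs ha) b (hs hb)⟩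
  induction hn : {c ∈ C | A.Le c x ∧ ¬ A.Le x c}.ncard using Nat.strong_induction_on
    generalizing x with
  | _ n ih =>
  obtain ⟨c, hc, hxc, hcx⟩ := hrep x
  by_cases hne : x = c
  · subst hne
    have hsub : {x} ⊆ C := Set.singleton_subset_iff.2 hc
    exact ⟨{x}, hsub, hflag _ hsub Set.subsingleton_singleton.isChain,
      by simp [Le.refl], mem_hull_singleton x⟩
  have hd := A.isIdx_idx c
  obtain ⟨y, hyc, hcy, t, ht0, ht1, hxy⟩ := exists_exit hd hxc hcx hne
  obtain ⟨b, hb, hyb, hby⟩ := hrep y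
  have hlt : {c ∈ C | A.Le c y ∧ ¬ A.Le y c}.ncard < n := by
    rw [← hn]
    refine Set.ncard_lt_ncard ⟨?_, fun h => ?_⟩ (hfin.subset fun a h => h.1)
    · rintro a ⟨haC, hay, hya⟩
      exact ⟨haC, (hay.trans hyc).trans hcx,
        fun hxa => hcy ((hcx.trans hxa).trans hay)⟩
    · exact (h ⟨hb, (hby.trans hyc).trans hcx,
        fun hxb => hcy ((hcx.trans hxb).trans hby)⟩).2.2 hyb
  obtain ⟨s, hsC, hs, hsy, hys⟩ := ih _ hlt y rfl
  have hsub : insert c s ⊆ C := Set.insert_subset hc hsC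
  refine ⟨insert c s, hsub, hflag _ hsub ?_, ?_, ?_⟩
  · exact hs.chain.insert fun a ha _ => Or.inr ((hsy a ha).trans hyc)
  · rintro a (rfl | ha)
    · exact hcx
    · exact ((hsy a ha).trans hyc).trans hcx
  · exact mem_hull_insert (fun a ha => (hsy a ha).trans hyc) hys (hxc.mem hd) ht0.le ht1.le hxy

/-- The hull of a flag is a Euclidean simplex whose faces are the hulls of the subsets of the
flag. -/
lemma IsFlag.exists_simplexChart {s : Set X} (hs : A.IsFlag s) (hne : s.Nonempty) :
    ∃ c : SimplexChart X, c.IsChartOf (A.hull s) ∧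
      (∀ σ : Set (Fin (c.k + 1)), σ.Nonempty →
        ∃ t ⊆ s, t.Nonempty ∧ c.face (A.hull s) σ = A.hull t) ∧
      ∀ t ⊆ s, ∃ σ, A.hull t = c.face (A.hull s) σ := by
  obtain ⟨i, hi⟩ := hs.exists_subset_cell hne
  have := hs.finite.to_subtype
  have := hne.to_subtype
  obtain ⟨k, hk⟩ : ∃ k, Nat.card s = k + 1 := Nat.exists_eq_succ_of_ne_zero Nat.card_pos.ne'
  let e : Fin (k + 1) ≃ s := (Finite.equivFinOfCardEq hk).symm
  have hface : ∀ σ : Set (Fin (k + 1)),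
      {a ∈ A.hull s | A.chart i a ∈ convexHull ℝ ((fun j => A.chart i (e j)) '' σ)} =
        A.hull ((fun j => (e j : X)) '' σ) := by
    intro σ
    have hsub : (fun j => (e j : X)) '' σ ⊆ s := by
      rintro _ ⟨j, -, rfl⟩
      exact (e j).2
    ext a
    rw [mem_hull_iff (hsub.trans hi), Set.image_image]
    refine ⟨fun h => ⟨((mem_hull_iff hi).1 h.1).1, h.2⟩, fun h => ⟨?_, h.2⟩⟩
    refine hull_mono hi hsub ((mem_hull_iff (hsub.trans hi)).2 ?_)
    rwa [Set.image_image]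
  refine ⟨⟨A.dim i, k, fun j => A.chart i (e j), A.chart i⟩, ⟨?_, ?_, ?_⟩, ?_, ?_⟩
  · exact (hs.affineIndependent hi).comp_embedding e.toEmbedding
  · intro a ha b hb
    exact A.dist_chart i a ((mem_hull_iff hi).1 ha).1 b ((mem_hull_iff hi).1 hb).1
  · simp only
    rw [image_hull hi]
    congr 1
    ext p
    constructor
    · rintro ⟨a, ha, rfl⟩
      exact ⟨e.symm ⟨a, ha⟩, by simp⟩
    · rintro ⟨j, rfl⟩
      exact ⟨e j, (e j).2, rfl⟩
  · intro σ hσ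
    refine ⟨(fun j => (e j : X)) '' σ, ?_, hσ.image _, hface σ⟩
    rintro _ ⟨j, -, rfl⟩
    exact (e j).2
  · intro t ht
    refine ⟨{j | (e j : X) ∈ t}, ?_⟩
    refine Eq.trans ?_ (hface _).symm
    congr 1
    ext a
    constructor
    · intro ha
      exact ⟨e.symm ⟨a, ht ha⟩, by simpa using ha, by simp⟩
    · rintro ⟨j, hj, rfl⟩
      exact hj

theorem isPolyhedralSpace (A : PolytopalAtlas X) : IsPolyhedralSpace X := by
  obtain ⟨C, hfin, hrep, hC⟩ := A.exists_representatives
  let F : Set (Set X) := {S | ∃ s ⊆ C, s.Nonempty ∧ A.IsFlag s ∧ A.hull s = S}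
  choose! s hsC hsne hs hsS using fun (S : Set X) (hS : S ∈ F) => hS
  choose chart hchart hface hsub using fun (S : Set X) (hS : S ∈ F) =>
    (hs S hS).exists_simplexChart (hsne S hS)
  refine ⟨F, chart, ?_, ?_, ?_, ?_, ?_⟩
  · refine (hfin.powerset.image A.hull).subset ?_
    rintro _ ⟨t, htC, -, -, rfl⟩
    exact ⟨t, htC, rfl⟩
  · refine Set.eq_univ_of_forall fun x => ?_
    obtain ⟨t, htC, ht, -, hx⟩ := exists_flag_mem_hull hfin hrep hC x
    refine ⟨A.hull t, ⟨t, htC, ?_, ht, rfl⟩, hx⟩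
    by_contra h
    rw [Set.not_nonempty_iff_eq_empty.1 h, hull_empty] at hx
    exact hx
  · intro S hS
    have := hchart S hS
    rwa [hsS S hS] at this
  · intro S hS σ hσ
    obtain ⟨t, hts, htne, ht⟩ := hface S hS σ hσ
    rw [hsS S hS] at ht
    exact ⟨t, hts.trans (hsC S hS), htne, (hs S hS).mono hts, ht.symm⟩
  · intro S hS T hT
    right
    have hST : S ∩ T = A.hull (s S ∩ s T) := by
      rw [← hull_inter hC (hsC S hS) (hsC T hT) (hs S hS) (hs T hT), hsS S hS, hsS T hT]
    obtain ⟨σ, hσ⟩ := hsub S hS _ (Set.inter_subset_left (t := s T))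
    obtain ⟨τ, hτ⟩ := hsub T hT _ (Set.inter_subset_right (s := s S))
    rw [hsS S hS] at hσ
    rw [hsS T hT] at hτ
    exact ⟨⟨σ, hST.trans hσ⟩, τ, hST.trans hτ⟩

end PolytopalAtlas

theorem polyhedral_of_polytopal_cover {X : Type*} [MetricSpace X] [CompactSpace X]
    (hX : IsLengthSpace X) (N : ℕ) (A : Fin N → Set X)
    (hcover : (⋃ i, A i) = Set.univ)
    (hpoly : ∀ s : Finset (Fin N), s.Nonempty → (⋂ i ∈ s, A i).Nonempty →
      IsometricToConvexPolytope (⋂ i ∈ s, A i)) :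
    IsPolyhedralSpace X := by
  have hpoly' : ∀ s : {s : Finset (Fin N) // s.Nonempty},
      IsometricToConvexPolytope (⋂ i ∈ s.1, A i) := by
    rintro ⟨s, hs⟩
    by_cases hne : (⋂ i ∈ s, A i).Nonempty
    · exact hpoly s hs hne
    · refine ⟨0, ∅, fun _ => 0, ?_, ?_⟩ <;> simp [Set.not_nonempty_iff_eq_empty.1 hne]
  choose n V f hdist himg using hpoly'
  classical
  refine PolytopalAtlas.isPolyhedralSpace
    { ι := {s : Finset (Fin N) // s.Nonempty}
      finite := inferInstance
      dim := n
      cell := fun s => ⋂ i ∈ s.1, A i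
      chart := f
      vert := fun s => V s
      finite_vert := fun s => (V s).finite_toSet
      dist_chart := hdist
      image_cell := himg
      inter := fun s t => ⟨⟨s.1 ∪ t.1, s.2.mono Finset.subset_union_left⟩, ?_⟩
      cover := fun x => ⟨⟨Finset.univ.filter fun i => x ∈ A i, ?_⟩, ?_, ?_⟩ }
  · ext x
    simp [or_imp, forall_and]
  · have hx : x ∈ ⋃ i, A i := hcover ▸ Set.mem_univ x
    obtain ⟨i, hi⟩ := Set.mem_iUnion.1 hx
    exact ⟨i, by simpa using hi⟩
  · simp
  · intro t ht y hy
    simp only [Set.mem_iInter, Finset.mem_filter, Finset.mem_univ, true_and] at ht hy ⊢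
    exact fun i hi => hy i (ht i hi)
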